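/- Let m ≥ 1 and d be integers with |d| ≥ 2 and gcd(m, d) = 1, and let 𝒱 be a set containing exactly one element of each orbit of the permutation v ↦ d·v of ℤ/m other than the orbit {0}. Then Σ(m,d) ≅ ⊕_{v ∈ 𝒱} ℤ/|d^{o(v)} − 1|. -/

import Mathlib

open Finset

noncomputable section

/-- The ring `ℤ[x]/(x^n - 1)`, realized as the group algebra `ℤ[ℤ/n]`;
the class of `x^j` (for `j : ℤ`) corresponds to `xp n (j : ZMod n)`. -/
abbrev Rn (n : ℕ) : Type := AddMonoidAlgebra ℤ (ZMod n)

/-- The class of `x^w` in `ℤ[x]/(x^n - 1)`. -/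
def xp (n : ℕ) (w : ZMod n) : Rn n := AddMonoidAlgebra.single w 1

/-- `e_v = x^v - 1`. -/
def eV (n : ℕ) (w : ZMod n) : Rn n := xp n w - 1

/-- `ε_v = d·e_v - e_{d·v}`. -/
def epsV (n : ℕ) (d : ℤ) (w : ZMod n) : Rn n := d • eV n w - eV n ((d : ZMod n) * w)

/-- `𝒵_n`, the ℤ-span of the `e_v`, `1 ≤ v ≤ n-1`. -/
def ZSpan (n : ℕ) : Submodule ℤ (Rn n) :=
  Submodule.span ℤ {a : Rn n | ∃ v : ℤ, 1 ≤ v ∧ v ≤ (n : ℤ) - 1 ∧ a = eV n (v : ZMod n)}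

/-- `ℰ_{n,d}`, the ℤ-span of the `ε_v`, `1 ≤ v ≤ n-1`. -/
def ESpan (n : ℕ) (d : ℤ) : Submodule ℤ (Rn n) :=
  Submodule.span ℤ {a : Rn n | ∃ v : ℤ, 1 ≤ v ∧ v ≤ (n : ℤ) - 1 ∧ a = epsV n d (v : ZMod n)}

/-- `1 + x + ⋯ + x^{|d|-1}`. -/
def geomT (n : ℕ) (d : ℤ) : Rn n := ∑ i ∈ Finset.range d.natAbs, xp n (i : ZMod n)

/-- `f_v`: the Laplacian row polynomial of `DB(n,d)` (for `d ≥ 0`) resp. of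
`Ktz(n,|d|)` (for `d < 0`). -/
def fV (n : ℕ) (d : ℤ) (v : ℤ) : Rn n :=
  if 0 ≤ d then d • xp n ((v : ZMod n)) - xp n (((d * v : ℤ) : ZMod n)) * geomT n d
  else d • xp n ((v : ZMod n)) + xp n (((d * (v + 1) : ℤ) : ZMod n)) * geomT n d

/-- `F_{n,d}`, the ℤ-span of the `f_v`, `1 ≤ v ≤ n-1`. -/
def FSpan (n : ℕ) (d : ℤ) : Submodule ℤ (Rn n) :=
  Submodule.span ℤ {a : Rn n | ∃ v : ℤ, 1 ≤ v ∧ v ≤ (n : ℤ) - 1 ∧ a = fV n d v}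

/-- The sand dune group `Σ(n,d) = 𝒵_n / ℰ_{n,d}`. -/
abbrev SandDune (n : ℕ) (d : ℤ) :=
  ZSpan n ⧸ Submodule.comap (ZSpan n).subtype (ESpan n d)

/-- The sandpile (critical) group `S(n,d) = 𝒵_n / F_{n,d}`. -/
abbrev Sandpile (n : ℕ) (d : ℤ) :=
  ZSpan n ⧸ Submodule.comap (ZSpan n).subtype (FSpan n d)

/-- An integer coprime to `m` is a unit modulo `m`. -/
lemma isUnit_intCast_of_gcd_eq_one {m : ℕ} {d : ℤ} (h : Int.gcd (m : ℤ) d = 1) :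
    IsUnit (d : ZMod m) := by
  have h' := (Int.isCoprime_iff_gcd_eq_one.2 h).map (Int.castRingHom (ZMod m))
  simpa [isCoprime_zero_left] using h'

lemma eV_zero (m : ℕ) : eV m 0 = 0 :=
  sub_self _

lemma eV_mul (m : ℕ) (d : ℤ) (w : ZMod m) :
    eV m ((d : ZMod m) * w) = d • eV m w - epsV m d w := by
  simp [epsV]

/-- Every nonzero residue modulo `m` is the class of an integer between `1` and `m - 1`. -/
lemma exists_intCast_eq {m : ℕ} [NeZero m] {w : ZMod m} (hw : w ≠ 0) :
    ∃ v : ℤ, 1 ≤ v ∧ v ≤ (m : ℤ) - 1 ∧ (v : ZMod m) = w := by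
  have h1 := ZMod.val_lt w
  have h2 : w.val ≠ 0 := (ZMod.val_eq_zero w).not.2 hw
  exact ⟨w.val, by omega, by omega, by simp⟩

lemma eV_mem_ZSpan {m : ℕ} [NeZero m] (w : ZMod m) : eV m w ∈ ZSpan m := by
  rcases eq_or_ne w 0 with rfl | hw
  · simp [eV_zero]
  · obtain ⟨v, h1, h2, rfl⟩ := exists_intCast_eq hw
    exact Submodule.subset_span ⟨v, h1, h2, rfl⟩

lemma epsV_mem_ESpan {m : ℕ} [NeZero m] (d : ℤ) (w : ZMod m) : epsV m d w ∈ ESpan m d := by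
  rcases eq_or_ne w 0 with rfl | hw
  · simp [epsV, eV_zero]
  · obtain ⟨v, h1, h2, rfl⟩ := exists_intCast_eq hw
    exact Submodule.subset_span ⟨v, h1, h2, rfl⟩

/-- Modulo `ℰ`, multiplying the index by `d ^ i` multiplies `e_w` by `d ^ i`. -/
lemma eV_pow_mul_sub_mem_ESpan {m : ℕ} [NeZero m] (d : ℤ) (w : ZMod m) (i : ℕ) :
    eV m ((d : ZMod m) ^ i * w) - d ^ i • eV m w ∈ ESpan m d := by
  induction i with
  | zero => simp
  | succ i ih =>
    have h := sub_mem ((ESpan m d).smul_mem d ih) (epsV_mem_ESpan d ((d : ZMod m) ^ i * w))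
    convert h using 1
    rw [pow_succ', mul_assoc, eV_mul, smul_sub, smul_smul, pow_succ']
    abel

/-- If `w = d ^ i * v`, this is `d ^ i` in `ZMod N`; if `w` is not in the orbit of `v`, it
is `0`. -/
def orbitCoord {m : ℕ} (d : ℤ) (N : ℕ) (v w : ZMod m) : ZMod N :=
  open Classical in
  if h : ∃ i : ℕ, (d : ZMod m) ^ i * v = w then (d : ZMod N) ^ h.choose else 0

lemma orbitCoord_of_not_exists {m : ℕ} {d : ℤ} {N : ℕ} {v w : ZMod m}
    (h : ¬ ∃ i : ℕ, (d : ZMod m) ^ i * v = w) : orbitCoord d N v w = 0 :=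
  dif_neg h

lemma pow_eq_pow_of_pow_mul_eq {m : ℕ} {d : ℤ} {N : ℕ} {v : ZMod m}
    (hu : IsUnit (d : ZMod m))
    (hN : ∀ k : ℕ, (d : ZMod m) ^ k * v = v → (d : ZMod N) ^ k = 1)
    {i j : ℕ} (h : (d : ZMod m) ^ i * v = (d : ZMod m) ^ j * v) :
    (d : ZMod N) ^ i = (d : ZMod N) ^ j := by
  wlog hij : i ≤ j generalizing i j
  · exact (this h.symm (le_of_not_ge hij)).symm
  obtain ⟨k, rfl⟩ := Nat.exists_eq_add_of_le hij
  rw [pow_add, mul_assoc] at h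
  rw [pow_add, hN k ((hu.pow i).mul_left_cancel h).symm, mul_one]

lemma orbitCoord_pow_mul {m : ℕ} {d : ℤ} {N : ℕ} {v : ZMod m}
    (hu : IsUnit (d : ZMod m))
    (hN : ∀ k : ℕ, (d : ZMod m) ^ k * v = v → (d : ZMod N) ^ k = 1) (i : ℕ) :
    orbitCoord d N v ((d : ZMod m) ^ i * v) = (d : ZMod N) ^ i := by
  have h : ∃ j : ℕ, (d : ZMod m) ^ j * v = (d : ZMod m) ^ i * v := ⟨i, rfl⟩
  rw [orbitCoord, dif_pos h]
  exact pow_eq_pow_of_pow_mul_eq hu hN h.choose_spec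

lemma orbitCoord_mul {m : ℕ} {d : ℤ} {N : ℕ} {v : ZMod m}
    (hu : IsUnit (d : ZMod m))
    (hN : ∀ k : ℕ, (d : ZMod m) ^ k * v = v → (d : ZMod N) ^ k = 1)
    {e : ℕ} (he : 0 < e) (hev : (d : ZMod m) ^ e * v = v) (w : ZMod m) :
    orbitCoord d N v ((d : ZMod m) * w) = d * orbitCoord d N v w := by
  by_cases h : ∃ i : ℕ, (d : ZMod m) ^ i * v = w
  · obtain ⟨i, rfl⟩ := h
    rw [← mul_assoc, ← pow_succ', orbitCoord_pow_mul hu hN, orbitCoord_pow_mul hu hN, pow_succ']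
  · rw [orbitCoord_of_not_exists h, mul_zero]
    refine orbitCoord_of_not_exists fun ⟨i, hi⟩ => h ⟨i + (e - 1), hu.mul_left_cancel ?_⟩
    rw [← mul_assoc, ← pow_succ', add_assoc, Nat.sub_add_cancel he, pow_add, mul_assoc, hev, hi]

lemma intCast_pow_eq_one (d : ℤ) (e : ℕ) : (d : ZMod (d ^ e - 1).natAbs) ^ e = 1 := by
  rw [← sub_eq_zero]
  have := (ZMod.intCast_zmod_eq_zero_iff_dvd (d ^ e - 1) (d ^ e - 1).natAbs).2
    (Int.natAbs_dvd.2 dvd_rfl)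
  simpa using this

/-- The powers of `d` fixing `v` are trivial modulo `d ^ e - 1`, where `e` is the period of `v`. -/
lemma intCast_pow_eq_one_of_pow_mul_eq {m : ℕ} {d : ℤ} {v : ZMod m} {e : ℕ} (he : 0 < e)
    (hev : (d : ZMod m) ^ e * v = v)
    (hmin : ∀ k : ℕ, 0 < k → (d : ZMod m) ^ k * v = v → e ≤ k)
    (k : ℕ) (hk : (d : ZMod m) ^ k * v = v) :
    (d : ZMod (d ^ e - 1).natAbs) ^ k = 1 := by
  have hmul (q : ℕ) : ((d : ZMod m) ^ e) ^ q * v = v := by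
    induction q with
    | zero => simp
    | succ q ih => rw [pow_succ, mul_assoc, hev, ih]
  have hmod : (d : ZMod m) ^ (k % e) * v = v := by
    rw [← Nat.mod_add_div k e, pow_add, pow_mul, mul_assoc, hmul] at hk
    exact hk
  have h0 : k % e = 0 := by
    by_contra h
    exact absurd (hmin _ (Nat.pos_of_ne_zero h) hmod) (not_le.2 (Nat.mod_lt k he))
  rw [← Nat.mod_add_div k e, h0, zero_add, pow_mul, intCast_pow_eq_one, one_pow]

/-- for `gcd(m,d) = 1` and a set `𝒱` of representatives of the
orbits of `v ↦ d·v` on `ℤ/m` other than `{0}`, one has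
`Σ(m,d) ≅ ⊕_{v ∈ 𝒱} ℤ/|d^{o(v)} − 1|`, where `o(v)` is the orbit size of `v`,
i.e. the least `e ≥ 1` with `d^e·v = v`. -/
theorem stmt12 (m : ℕ) (d : ℤ) (hm : 1 ≤ m) (hd : 2 ≤ |d|)
    (hcop : Int.gcd (m : ℤ) d = 1)
    (V : Finset (ZMod m)) (h0 : (0 : ZMod m) ∉ V)
    (hcover : ∀ w : ZMod m, w ≠ 0 → ∃ v ∈ V, ∃ i : ℕ, (d : ZMod m) ^ i * v = w)
    (hsep : ∀ v ∈ V, ∀ v' ∈ V, (∃ i : ℕ, (d : ZMod m) ^ i * v = v') → v = v')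
    (o : ZMod m → ℕ)
    (ho : ∀ w : ZMod m, 0 < o w ∧ (d : ZMod m) ^ (o w) * w = w ∧
      ∀ e : ℕ, 0 < e → (d : ZMod m) ^ e * w = w → o w ≤ e) :
    Nonempty (SandDune m d ≃+ ((v : V) → ZMod ((d ^ o v.1 - 1).natAbs))) := by
  classical
  have : NeZero m := ⟨by omega⟩
  have hu := isUnit_intCast_of_gcd_eq_one hcop
  have hN (v : V) := intCast_pow_eq_one_of_pow_mul_eq (ho v.1).1 (ho v.1).2.1 (ho v.1).2.2
  let c (w : ZMod m) (v : V) : ZMod (d ^ o v.1 - 1).natAbs := orbitCoord d _ v.1 w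
  have hc_zero : c 0 = 0 := by
    funext v
    refine orbitCoord_of_not_exists fun ⟨i, hi⟩ => h0 ?_
    rw [← (hu.pow i).mul_right_eq_zero.1 hi]
    exact v.2
  have hc_mul (w : ZMod m) : c ((d : ZMod m) * w) = d • c w := by
    funext v
    simpa using orbitCoord_mul hu (hN v) (ho v.1).1 (ho v.1).2.1 w
  have hc_self (v : V) : c v.1 = Pi.single v 1 := by
    funext v'
    rcases eq_or_ne v' v with rfl | hne
    · simpa using orbitCoord_pow_mul hu (hN v') 0
    · rw [Pi.single_eq_of_ne hne]
      exact orbitCoord_of_not_exists fun h => hne (Subtype.ext (hsep _ v'.2 _ v.2 h))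
  let L : Rn m →ₗ[ℤ] ((v : V) → ZMod ((d ^ o v.1 - 1).natAbs)) :=
    Finsupp.linearCombination ℤ c ∘ₗ (AddMonoidAlgebra.coeffLinearEquiv ℤ).toLinearMap
  have hL (w : ZMod m) : L (eV m w) = c w := by
    have hxp (w : ZMod m) : L (xp m w) = c w := by
      simp [L, xp, AddMonoidAlgebra.coeffLinearEquiv]
    have hone : L 1 = 0 := (hxp 0).trans hc_zero
    rw [eV, map_sub, hxp, hone, sub_zero]
  have hE : ESpan m d ≤ LinearMap.ker L := by
    refine Submodule.span_le.2 ?_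
    rintro _ ⟨v, -, -, rfl⟩
    rw [SetLike.mem_coe, LinearMap.mem_ker, epsV, map_sub, map_smul, hL, hL, hc_mul, sub_self]
  have hLsum (a : V → ℤ) (v : V) : L (∑ u : V, a u • eV m u.1) v = a v := by
    simp only [map_sum, map_smul, hL, hc_self, Finset.sum_apply, Pi.smul_apply]
    rw [Finset.sum_eq_single v (fun u _ hu => by rw [Pi.single_eq_of_ne' hu, smul_zero])
      (fun h => absurd (Finset.mem_univ v) h), Pi.single_eq_same, zsmul_one]
  have hnormal : ∀ x ∈ ZSpan m, ∃ a : V → ℤ, x - ∑ u : V, a u • eV m u.1 ∈ ESpan m d := by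
    intro x hx
    induction hx using Submodule.span_induction with
    | mem x hx =>
      obtain ⟨w, -, -, rfl⟩ := hx
      rcases eq_or_ne (w : ZMod m) 0 with hw | hw
      · exact ⟨0, by simp [hw, eV_zero]⟩
      · obtain ⟨v, hv, i, hi⟩ := hcover _ hw
        refine ⟨Pi.single ⟨v, hv⟩ (d ^ i), ?_⟩
        simpa [Pi.single_apply, ite_smul, hi] using eV_pow_mul_sub_mem_ESpan d v i
    | zero => exact ⟨0, by simp⟩
    | add x y _ _ hx hy =>
      obtain ⟨a, ha⟩ := hx
      obtain ⟨b, hb⟩ := hy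
      refine ⟨a + b, ?_⟩
      convert add_mem ha hb using 1
      simp only [Pi.add_apply, add_smul, Finset.sum_add_distrib]
      abel
    | smul r x _ hx =>
      obtain ⟨a, ha⟩ := hx
      refine ⟨r • a, ?_⟩
      convert (ESpan m d).smul_mem r ha using 1
      simp [smul_sub, Finset.smul_sum, mul_smul]
  have hker : ∀ x ∈ ZSpan m, L x = 0 → x ∈ ESpan m d := by
    intro x hx hx0
    obtain ⟨a, ha⟩ := hnormal x hx
    have hLa : L (∑ u : V, a u • eV m u.1) = 0 := by
      simpa [hx0] using hE ha
    refine (Submodule.sub_mem_iff_left _ (Submodule.sum_mem _ fun u _ => ?_)).1 ha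
    have hdvd : d ^ o u.1 - 1 ∣ a u := by
      rw [← Int.natAbs_dvd, ← ZMod.intCast_zmod_eq_zero_iff_dvd, ← hLsum, hLa, Pi.zero_apply]
    obtain ⟨b, hb⟩ := hdvd
    have h := eV_pow_mul_sub_mem_ESpan d u.1 (o u.1)
    rw [(ho u.1).2.1] at h
    rw [hb]
    convert (ESpan m d).smul_mem (-b) h using 1
    module
  let φ : ZSpan m →ₗ[ℤ] ((v : V) → ZMod ((d ^ o v.1 - 1).natAbs)) := L ∘ₗ (ZSpan m).subtype
  have hφker : Submodule.comap (ZSpan m).subtype (ESpan m d) = LinearMap.ker φ := by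
    ext x
    exact ⟨fun h => hE h, fun h => hker x x.2 h⟩
  have hφsurj : Function.Surjective φ := by
    intro f
    choose a ha using fun v : V => ZMod.intCast_surjective (f v)
    refine ⟨⟨∑ u : V, a u • eV m u.1,
      Submodule.sum_mem _ fun u _ => Submodule.smul_mem _ _ (eV_mem_ZSpan _)⟩, ?_⟩
    funext v
    exact (hLsum a v).trans (ha v)
  exact ⟨((Submodule.quotEquivOfEq _ _ hφker).trans
    (φ.quotKerEquivOfSurjective hφsurj)).toAddEquiv⟩
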